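/- For every τ ∈ [0,1] and every s ∈ ℂ that is not an integer, φ_τ(s) = W(s)·φ_τ(1−s). (Theorem 1, functional-equation part: every convex combination of f₀ and f₁ satisfies the same Riemann-type functional equation.) -/

import Mathlib

open Complex

local instance : Fact (Nat.Prime 5) := ⟨by norm_num⟩

/-- The quadratic Dirichlet character modulo 5 (the unique real nonprincipal
character mod 5, with values `χ₅ 1 = χ₅ 4 = 1` and `χ₅ 2 = χ₅ 3 = -1`). -/
noncomputable def chi5 : DirichletCharacter ℂ 5 :=
  (quadraticChar (ZMod 5)).ringHomComp (Int.castRingHom ℂ)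

/-- `f₀ s = (1 + 5^(1/2 - s)) ζ(s)`. -/
noncomputable def f0 (s : ℂ) : ℂ :=
  (1 + (5 : ℂ) ^ ((1 : ℂ) / 2 - s)) * riemannZeta s

/-- `f₁ s = L(s, χ₅)`, the (entire) Dirichlet L-function of `χ₅`. -/
noncomputable def f1 (s : ℂ) : ℂ := DirichletCharacter.LFunction chi5 s

/-- `W s = 5^(1/2-s) · 2 · (2π)^(s-1) · Γ(1-s) · sin(πs/2)`. -/
noncomputable def W (s : ℂ) : ℂ :=
  (5 : ℂ) ^ ((1 : ℂ) / 2 - s) * 2 * (2 * (Real.pi : ℂ)) ^ (s - 1) *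
    Complex.Gamma (1 - s) * Complex.sin ((Real.pi : ℂ) * s / 2)

/-- `φ_τ s = (1 - τ) f₀ s + τ f₁ s`. -/
noncomputable def phi (τ : ℝ) (s : ℂ) : ℂ := (1 - (τ : ℂ)) * f0 s + (τ : ℂ) * f1 s

lemma chi5_apply (a : ZMod 5) : chi5 a = (quadraticChar (ZMod 5) a : ℂ) := rfl

lemma chi5_even : chi5.Even := by
  have h : quadraticChar (ZMod 5) (-1) = 1 := by decide
  simp [DirichletCharacter.Even, chi5_apply, h]

lemma chi5_isPrimitive : chi5.IsPrimitive := by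
  rw [DirichletCharacter.isPrimitive_def]
  refine ((Nat.dvd_prime Nat.prime_five).mp chi5.conductor_dvd_level).resolve_left fun h ↦ ?_
  rw [← DirichletCharacter.eq_one_iff_conductor_eq_one] at h
  have h2 : chi5 2 = 1 := by
    rw [h, MulChar.one_apply (by decide : IsUnit (2 : ZMod 5))]
  have hq : quadraticChar (ZMod 5) 2 = -1 := by decide
  norm_num [chi5_apply, hq] at h2

lemma inv_chi5 : chi5⁻¹ = chi5 :=
  ((quadraticChar_isQuadratic (ZMod 5)).comp (Int.castRingHom ℂ)).inv

lemma gaussSum_chi5 : gaussSum chi5 ZMod.stdAddChar = (5 : ℂ) ^ (1 / 2 : ℂ) := by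
  have h0 : quadraticChar (ZMod 5) 0 = 0 := by decide
  have h1 : quadraticChar (ZMod 5) 1 = 1 := by decide
  have h2 : quadraticChar (ZMod 5) 2 = -1 := by decide
  have h3 : quadraticChar (ZMod 5) (-2) = -1 := by decide
  have h4 : quadraticChar (ZMod 5) (-1) = 1 := by decide
  have hsum (f : ZMod 5 → ℂ) : ∑ a, f a = f 0 + f 1 + f 2 + f (-2) + f (-1) :=
    Fin.sum_univ_five f
  have hψ (k : ℤ) : ZMod.stdAddChar (k : ZMod 5) = cexp ((2 * Real.pi * k / 5 : ℝ) * I) := by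
    rw [ZMod.stdAddChar_coe]
    push_cast
    ring_nf
  have hψ1 := hψ 1
  have hψ2 := hψ 2
  have hψ3 := hψ (-2)
  have hψ4 := hψ (-1)
  have hc1 : Real.cos (2 * Real.pi / 5) = (Real.sqrt 5 - 1) / 4 := by
    have h := Real.cos_two_mul (Real.pi / 5)
    rw [Real.cos_pi_div_five] at h
    rw [mul_div_assoc, h]
    nlinarith [Real.sq_sqrt (show (0 : ℝ) ≤ 5 by norm_num)]
  have hc2 : Real.cos (2 * Real.pi * 2 / 5) = -(1 + Real.sqrt 5) / 4 := by
    rw [show 2 * Real.pi * 2 / 5 = Real.pi - Real.pi / 5 by ring, Real.cos_pi_sub,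
      Real.cos_pi_div_five]
    ring
  have hr : (5 : ℂ) ^ (1 / 2 : ℂ) = (Real.sqrt 5 : ℝ) := by
    rw [Real.sqrt_eq_rpow, Complex.ofReal_cpow (by norm_num)]
    norm_num
  push_cast at hψ1 hψ2 hψ3 hψ4
  rw [gaussSum, hsum, hr]
  simp only [chi5_apply, h0, h1, h2, h3, h4, hψ1, hψ2, hψ3, hψ4]
  have e1 := Complex.two_cos (2 * Real.pi / 5 : ℝ)
  have e2 := Complex.two_cos (2 * Real.pi * 2 / 5 : ℝ)
  rw [← Complex.ofReal_cos, hc1] at e1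
  rw [← Complex.ofReal_cos, hc2] at e2
  push_cast at e1 e2 ⊢
  ring_nf at e1 e2 ⊢
  linear_combination e2 - e1

open scoped ZMod in
lemma dft_chi5 : 𝓕 (chi5 : ZMod 5 → ℂ) = fun a ↦ (5 : ℂ) ^ (1 / 2 : ℂ) * chi5 a := by
  ext a
  rw [chi5_isPrimitive.fourierTransform_eq_inv_mul_gaussSum, inv_chi5, gaussSum_chi5,
    chi5_even.eval_neg]
  ring

lemma ZMod.LFunction_const_mul {N : ℕ} [NeZero N] (c : ℂ) (Φ : ZMod N → ℂ) (s : ℂ) :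
    ZMod.LFunction (fun a ↦ c * Φ a) s = c * ZMod.LFunction Φ s := by
  simp only [ZMod.LFunction, mul_assoc, ← Finset.mul_sum]
  ring

lemma f0_eq_W_mul {s : ℂ} (hs : ∀ n : ℤ, s ≠ n) : f0 s = W s * f0 (1 - s) := by
  have h := riemannZeta_one_sub (s := 1 - s)
    (fun n hn ↦ hs (n + 1) (by push_cast; linear_combination -hn))
    (fun h1 ↦ hs 0 (by push_cast; linear_combination -h1))
  rw [sub_sub_cancel, neg_sub, show (Real.pi : ℂ) * (1 - s) / 2 = Real.pi / 2 - Real.pi * s / 2 by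
    ring, Complex.cos_pi_div_two_sub] at h
  have h5 : (5 : ℂ) ^ ((1 : ℂ) / 2 - s) * (5 : ℂ) ^ ((1 : ℂ) / 2 - (1 - s)) = 1 := by
    rw [← Complex.cpow_add _ _ (by norm_num), show (1 : ℂ) / 2 - s + (1 / 2 - (1 - s)) = 0 by ring,
      Complex.cpow_zero]
  rw [f0, f0, W, h]
  linear_combination -(2 * (2 * (Real.pi : ℂ)) ^ (s - 1) * Complex.Gamma (1 - s) *
    Complex.sin ((Real.pi : ℂ) * s / 2) * riemannZeta (1 - s)) * h5

lemma f1_eq_W_mul {s : ℂ} (hs : ∀ n : ℤ, s ≠ n) : f1 s = W s * f1 (1 - s) := by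
  have h := ZMod.LFunction_one_sub (chi5 : ZMod 5 → ℂ) (s := 1 - s)
    (fun n hn ↦ hs (n + 1) (by push_cast; linear_combination -hn))
    (.inr fun h1 ↦ hs 0 (by push_cast; linear_combination -h1))
  simp only [chi5_even.eval_neg] at h
  rw [dft_chi5, ZMod.LFunction_const_mul, sub_sub_cancel, neg_sub] at h
  have h5 : (5 : ℂ) ^ ((1 : ℂ) / 2 - s) = (5 : ℂ) ^ (1 - s - 1) * (5 : ℂ) ^ (1 / 2 : ℂ) := by
    rw [← Complex.cpow_add _ _ (by norm_num)]
    ring_nf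
  have hsin : cexp (Real.pi * I * (1 - s) / 2) + cexp (-Real.pi * I * (1 - s) / 2) =
      2 * Complex.sin (Real.pi * s / 2) := by
    rw [← Complex.cos_pi_div_two_sub, Complex.two_cos]
    ring_nf
  rw [f1, f1, W, h5]
  change ZMod.LFunction (chi5 : ZMod 5 → ℂ) s = _ * ZMod.LFunction (chi5 : ZMod 5 → ℂ) (1 - s)
  rw [h, ← add_mul, hsin]
  push_cast
  ring

/-- Theorem 1 (functional-equation part): for every `τ ∈ [0,1]` and every `s`
that is not an integer, `φ_τ s = W s · φ_τ (1 - s)`. -/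
theorem stmt0 (τ : ℝ) (hτ : τ ∈ Set.Icc (0 : ℝ) 1) (s : ℂ)
    (hs : ∀ n : ℤ, s ≠ (n : ℂ)) :
    phi τ s = W s * phi τ (1 - s) := by
  rw [phi, phi, f0_eq_W_mul hs, f1_eq_W_mul hs]
  ring
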